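/- arXiv:math/9710205 — 2 statements merged into one kernel-verified Lean document; each statement's English description precedes it below -/
import Mathlib

section
/- For integers n ≥ 10⁹ define a_n = 1/ln n, γ_n = e^{(ln n)^{1/2}}, b_n = e^{−γ_n}, δ_n = e^{−γ_n^{1/4}}, c_n = a_n − δ_n, d_n = a_n + δ_n, β_n = 1 − (ln n + (3/2) ln γ_n)/γ_n, and define Ω̃ on [0,1] by Ω̃(x) = Σ_{n=10⁹}^{∞} ( |x−c_n|^{−β_n} χ_{(c_n−b_n, c_n)}(x) − |x−d_n|^{−β_n} χ_{(d_n−b_n, d_n)}(x) ). Then Ω̃ ∈ L¹([0,1]), ∫₀¹ Ω̃(x) dx = 0, and for every α > 0, sup_{0 ≤ z ≤ 1} ∫₀¹ |Ω̃(x)| (ln(1/|x−z|))^{1+α} dx < ∞. -/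
open MeasureTheory Metric
open scoped ENNReal

noncomputable section

/-- `a_n = 1/ln n`. -/
def aseq (n : ℕ) : ℝ := 1 / Real.log n

/-- `γ_n = e^{(ln n)^{1/2}}`. -/
def gseq (n : ℕ) : ℝ := Real.exp (Real.sqrt (Real.log n))

/-- `b_n = e^{-γ_n}`. -/
def bseq (n : ℕ) : ℝ := Real.exp (-gseq n)

/-- `δ_n = e^{-γ_n^{1/4}}`. -/
def dlt (n : ℕ) : ℝ := Real.exp (-(gseq n ^ ((1 : ℝ) / 4)))

/-- `c_n = a_n - δ_n`. -/
def cseq (n : ℕ) : ℝ := aseq n - dlt n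

/-- `d_n = a_n + δ_n`. -/
def dseq (n : ℕ) : ℝ := aseq n + dlt n

/-- `β_n = 1 - (ln n + (3/2) ln γ_n)/γ_n`. -/
def bet (n : ℕ) : ℝ := 1 - (Real.log n + (3 / 2) * Real.log (gseq n)) / gseq n

/-- The function `Ω̃` on `[0,1]`: a sum of spikes with pairwise disjoint supports. -/
def Omt (x : ℝ) : ℝ :=
  ∑' n : ℕ, if 10 ^ 9 ≤ n then
    Set.indicator (Set.Ioo (cseq n - bseq n) (cseq n)) (fun t => |t - cseq n| ^ (-bet n)) x -
    Set.indicator (Set.Ioo (dseq n - bseq n) (dseq n)) (fun t => |t - dseq n| ^ (-bet n)) x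
  else 0

/-- The one-sided power singularity `|x - c| ^ (-β)` cut off to the interval `(c - b, c)`. -/
def spike (c b β : ℝ) : ℝ → ℝ :=
  Set.indicator (Set.Ioo (c - b) c) fun t => |t - c| ^ (-β)

lemma spike_nonneg (c b β x : ℝ) : 0 ≤ spike c b β x :=
  Set.indicator_nonneg (fun _ _ => Real.rpow_nonneg (abs_nonneg _) _) x

lemma measurable_spike (c b β : ℝ) : Measurable (spike c b β) :=
  Measurable.indicator (by fun_prop) measurableSet_Ioo

lemma lintegral_Ioo_abs_rpow {b q : ℝ} (hb : 0 ≤ b) (hq : q < 1) :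
    ∫⁻ x in Set.Ioo 0 b, ENNReal.ofReal (|x| ^ (-q)) =
      ENNReal.ofReal (b ^ (1 - q) / (1 - q)) := by
  have hint : IntegrableOn (fun x : ℝ => x ^ (-q)) (Set.Ioc 0 b) :=
    (intervalIntegrable_iff_integrableOn_Ioc_of_le hb).1
      (intervalIntegral.intervalIntegrable_rpow' (by linarith))
  rw [← setLIntegral_congr (Ioo_ae_eq_Ioc (a := (0 : ℝ)) (b := b)).symm]
  have hcongr : ∫⁻ x in Set.Ioc 0 b, ENNReal.ofReal (|x| ^ (-q)) =
      ∫⁻ x in Set.Ioc 0 b, ENNReal.ofReal (x ^ (-q)) :=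
    setLIntegral_congr_fun measurableSet_Ioc fun x hx => by simp only [abs_of_pos hx.1]
  rw [hcongr, ← ofReal_integral_eq_lintegral_ofReal hint
    ((ae_restrict_mem measurableSet_Ioc).mono fun x hx => Real.rpow_nonneg hx.1.le _),
    ← intervalIntegral.integral_of_le hb, integral_rpow (Or.inl (by linarith)),
    Real.zero_rpow (by linarith)]
  congr 2 <;> ring_nf

lemma lintegral_abs_sub_rpow_left (c : ℝ) {b q : ℝ} (hb : 0 ≤ b) (hq : q < 1) :
    ∫⁻ x in Set.Ioo (c - b) c, ENNReal.ofReal (|x - c| ^ (-q)) =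
      ENNReal.ofReal (b ^ (1 - q) / (1 - q)) := by
  rw [← lintegral_Ioo_abs_rpow hb hq, ← lintegral_indicator measurableSet_Ioo,
    ← lintegral_indicator measurableSet_Ioo, ← lintegral_sub_left_eq_self ((Set.Ioo 0 b).indicator _) c]
  refine lintegral_congr fun x => ?_
  simp only [Set.indicator, Set.mem_Ioo, abs_sub_comm c x]
  congr 1
  exact propext ⟨fun h => ⟨by linarith [h.2], by linarith [h.1]⟩,
    fun h => ⟨by linarith [h.2], by linarith [h.1]⟩⟩

lemma lintegral_abs_sub_rpow_right (c : ℝ) {b q : ℝ} (hb : 0 ≤ b) (hq : q < 1) :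
    ∫⁻ x in Set.Ioo c (c + b), ENNReal.ofReal (|x - c| ^ (-q)) =
      ENNReal.ofReal (b ^ (1 - q) / (1 - q)) := by
  rw [← lintegral_Ioo_abs_rpow hb hq, ← lintegral_indicator measurableSet_Ioo,
    ← lintegral_indicator measurableSet_Ioo, ← lintegral_sub_right_eq_self ((Set.Ioo 0 b).indicator _) c]
  refine lintegral_congr fun x => ?_
  simp only [Set.indicator, Set.mem_Ioo]
  congr 1
  exact propext ⟨fun h => ⟨by linarith [h.1], by linarith [h.2]⟩,
    fun h => ⟨by linarith [h.1], by linarith [h.2]⟩⟩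

lemma lintegral_abs_sub_rpow_ball_le (c : ℝ) {b q : ℝ} (hb : 0 ≤ b) (hq : q < 1) :
    ∫⁻ x in Set.Ioo (c - b) (c + b), ENNReal.ofReal (|x - c| ^ (-q)) ≤
      2 * ENNReal.ofReal (b ^ (1 - q) / (1 - q)) := by
  have hsub : Set.Ioo (c - b) (c + b) ⊆ Set.Ioc (c - b) c ∪ Set.Ioo c (c + b) := fun x hx =>
    (le_or_gt x c).imp (fun h => ⟨hx.1, h⟩) fun h => ⟨h, hx.2⟩
  refine (lintegral_mono_set hsub).trans ((lintegral_union_le _ _ _).trans ?_)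
  rw [← setLIntegral_congr (Ioo_ae_eq_Ioc (a := c - b) (b := c)),
    lintegral_abs_sub_rpow_left c hb hq, lintegral_abs_sub_rpow_right c hb hq, two_mul]

lemma ofReal_spike_mul (c b β w x : ℝ) :
    ENNReal.ofReal (spike c b β x * w) =
      (Set.Ioo (c - b) c).indicator (fun t => ENNReal.ofReal (|t - c| ^ (-β) * w)) x := by
  by_cases hx : x ∈ Set.Ioo (c - b) c <;> simp [spike, hx]

lemma lintegral_spike (c : ℝ) {b β : ℝ} (hb : 0 ≤ b) (hβ : β < 1) :
    ∫⁻ x, ENNReal.ofReal (spike c b β x) = ENNReal.ofReal (b ^ (1 - β) / (1 - β)) := by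
  rw [← lintegral_abs_sub_rpow_left c hb hβ, ← lintegral_indicator measurableSet_Ioo]
  refine lintegral_congr fun x => ?_
  simpa using ofReal_spike_mul c b β 1 x

lemma integrable_spike (c : ℝ) {b β : ℝ} (hb : 0 ≤ b) (hβ : β < 1) :
    Integrable (spike c b β) := by
  refine ⟨(measurable_spike c b β).aestronglyMeasurable, ?_⟩
  rw [hasFiniteIntegral_iff_ofReal (Filter.Eventually.of_forall (spike_nonneg c b β)),
    lintegral_spike c hb hβ]
  exact ENNReal.ofReal_lt_top

lemma integral_spike (c : ℝ) {b β : ℝ} (hb : 0 ≤ b) (hβ : β < 1) :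
    ∫ x, spike c b β x = b ^ (1 - β) / (1 - β) := by
  rw [integral_eq_lintegral_of_nonneg_ae (Filter.Eventually.of_forall (spike_nonneg c b β))
    (measurable_spike c b β).aestronglyMeasurable, lintegral_spike c hb hβ,
    ENNReal.toReal_ofReal (div_nonneg (Real.rpow_nonneg hb _) (by linarith))]

lemma setIntegral_Icc_spike {c b β : ℝ} (hb : 0 ≤ b) (hβ : β < 1) (h0 : 0 ≤ c - b) (h1 : c ≤ 1) :
    ∫ x in Set.Icc (0 : ℝ) 1, spike c b β x = b ^ (1 - β) / (1 - β) := by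
  rw [← integral_spike c hb hβ]
  refine setIntegral_eq_integral_of_forall_compl_eq_zero fun x hx => ?_
  exact Set.indicator_of_notMem
    (fun h => hx ⟨by linarith [h.1], by linarith [h.2]⟩) _

/-- A weight that is at most `W` on the support of a spike multiplies its mass by at most `W`. -/
lemma setLIntegral_spike_mul_le (s : Set ℝ) {c b β W : ℝ} {w : ℝ → ℝ} (hb : 0 ≤ b) (hβ : β < 1)
    (hs : MeasurableSet s) (hw : ∀ x ∈ s, x ∈ Set.Ioo (c - b) c → w x ≤ W) :
    ∫⁻ x in s, ENNReal.ofReal (spike c b β x * w x) ≤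
      ENNReal.ofReal (b ^ (1 - β) / (1 - β) * W) := by
  calc ∫⁻ x in s, ENNReal.ofReal (spike c b β x * w x)
      ≤ ∫⁻ x in s, ENNReal.ofReal (spike c b β x) * ENNReal.ofReal W := by
        refine setLIntegral_mono' hs fun x hxs => ?_
        rw [← ENNReal.ofReal_mul (spike_nonneg c b β x)]
        refine ENNReal.ofReal_le_ofReal ?_
        by_cases hx : x ∈ Set.Ioo (c - b) c
        · exact mul_le_mul_of_nonneg_left (hw x hxs hx) (spike_nonneg c b β x)
        · simp [spike, hx]
    _ ≤ ∫⁻ x, ENNReal.ofReal (spike c b β x) * ENNReal.ofReal W := setLIntegral_le_lintegral _ _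
    _ = _ := by
        rw [lintegral_mul_const' _ _ ENNReal.ofReal_ne_top, lintegral_spike c hb hβ,
          ENNReal.ofReal_mul (div_nonneg (Real.rpow_nonneg hb _) (by linarith))]

lemma log_one_div_rpow_le {u ε p : ℝ} (hu : 0 ≤ u) (hu1 : u ≤ 1) (hε : 0 < ε) (hp : 0 < p) :
    Real.log (1 / u) ^ p ≤ (p / ε) ^ p * u ^ (-ε) := by
  have hlog : 0 ≤ Real.log (1 / u) := by
    rw [one_div, Real.log_inv]
    linarith [Real.log_nonpos hu hu1]
  have h := Real.rpow_le_rpow hlog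
    (Real.log_le_rpow_div (one_div_nonneg.2 hu) (div_pos hε hp)) hp.le
  refine h.trans (le_of_eq ?_)
  rw [div_eq_mul_inv, Real.mul_rpow (by positivity) (by positivity), ← Real.rpow_mul (by positivity),
    div_mul_cancel₀ _ hp.ne', inv_div, one_div, Real.inv_rpow hu, Real.rpow_neg hu, mul_comm]

lemma rpow_neg_mul_rpow_neg_le {u v β ε : ℝ} (hu : 0 < u) (hv : 0 ≤ v) (hβ : 0 ≤ β) (hε : 0 < ε) :
    u ^ (-β) * v ^ (-ε) ≤ if v < u then v ^ (-(β + ε)) else u ^ (-(β + ε)) := by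
  split_ifs with h
  · rcases hv.eq_or_lt with rfl | hv
    · rw [Real.zero_rpow (by linarith), mul_zero]
      exact Real.rpow_nonneg le_rfl _
    · rw [neg_add, Real.rpow_add hv]
      exact mul_le_mul_of_nonneg_right
        (Real.rpow_le_rpow_of_nonpos hv h.le (by linarith)) (by positivity)
  · rw [neg_add, Real.rpow_add hu]
    exact mul_le_mul_of_nonneg_left
      (Real.rpow_le_rpow_of_nonpos hu (not_lt.1 h) (by linarith)) (by positivity)

/-- A bound for the logarithmic moment of a spike, uniform in the centre `z`. -/
lemma lintegral_spike_mul_log_le {c b β p z : ℝ} (hb : 0 ≤ b) (hβ0 : 0 ≤ β) (hβ : β < 1)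
    (hp : 0 < p) (hz : z ∈ Set.Icc (0 : ℝ) 1) :
    ∫⁻ x in Set.Icc (0 : ℝ) 1,
        ENNReal.ofReal (spike c b β x * Real.log (1 / |x - z|) ^ p) ≤
      ENNReal.ofReal
        ((2 * p / (1 - β)) ^ p * (3 * (b ^ ((1 - β) / 2) / ((1 - β) / 2)))) := by
  set ε : ℝ := (1 - β) / 2 with hε_def
  have hε : 0 < ε := by rw [hε_def]; linarith
  have hq : β + ε < 1 := by rw [hε_def]; linarith
  have hq' : 1 - (β + ε) = ε := by rw [hε_def]; ring
  have hK : 0 ≤ (p / ε) ^ p := by positivity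
  let A : ℝ → ℝ≥0∞ := (Set.Ioo (c - b) c).indicator
    fun x => ENNReal.ofReal (|x - c| ^ (-(β + ε)))
  let B : ℝ → ℝ≥0∞ := (Set.Ioo (z - b) (z + b)).indicator
    fun x => ENNReal.ofReal (|x - z| ^ (-(β + ε)))
  have hA : Measurable A := Measurable.indicator (by fun_prop) measurableSet_Ioo
  have hpt : ∀ x ∈ Set.Icc (0 : ℝ) 1,
      ENNReal.ofReal (spike c b β x * Real.log (1 / |x - z|) ^ p) ≤
        ENNReal.ofReal ((p / ε) ^ p) * (A x + B x) := by
    intro x hx01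
    by_cases hx : x ∈ Set.Ioo (c - b) c
    · have hxz : |x - z| ≤ 1 := abs_le.2 ⟨by linarith [hx01.1, hz.2], by linarith [hx01.2, hz.1]⟩
      have hxc : |x - c| = c - x := by rw [abs_sub_comm, abs_of_pos (by linarith [hx.2])]
      have hu : 0 < |x - c| := by rw [hxc]; linarith [hx.2]
      have h1 : spike c b β x * Real.log (1 / |x - z|) ^ p ≤
          (p / ε) ^ p * (|x - c| ^ (-β) * |x - z| ^ (-ε)) := by
        rw [spike, Set.indicator_of_mem hx]
        calc _ ≤ |x - c| ^ (-β) * ((p / ε) ^ p * |x - z| ^ (-ε)) :=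
              mul_le_mul_of_nonneg_left (log_one_div_rpow_le (abs_nonneg _) hxz hε hp)
                (by positivity)
          _ = _ := by ring
      refine (ENNReal.ofReal_le_ofReal (h1.trans (mul_le_mul_of_nonneg_left
        (rpow_neg_mul_rpow_neg_le hu (abs_nonneg _) hβ0 hε) hK))).trans ?_
      rw [ENNReal.ofReal_mul hK]
      refine mul_le_mul_right ?_ _
      split_ifs with hlt
      · have hmem : x ∈ Set.Ioo (z - b) (z + b) := by
          have := abs_lt.1 (hlt.trans (by rw [hxc]; linarith [hx.1] : |x - c| < b))
          exact ⟨by linarith [this.1], by linarith [this.2]⟩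
        exact le_add_left (by simp only [B, Set.indicator_of_mem hmem]; exact le_rfl)
      · exact le_add_right (by simp only [A, Set.indicator_of_mem hx]; exact le_rfl)
    · simp [spike, hx]
  calc _ ≤ ∫⁻ x in Set.Icc (0 : ℝ) 1, ENNReal.ofReal ((p / ε) ^ p) * (A x + B x) :=
        setLIntegral_mono' measurableSet_Icc hpt
    _ ≤ ∫⁻ x, ENNReal.ofReal ((p / ε) ^ p) * (A x + B x) := setLIntegral_le_lintegral _ _
    _ = ENNReal.ofReal ((p / ε) ^ p) * ((∫⁻ x, A x) + ∫⁻ x, B x) := by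
        rw [lintegral_const_mul' _ _ ENNReal.ofReal_ne_top, lintegral_add_left hA]
    _ ≤ ENNReal.ofReal ((p / ε) ^ p) *
        (ENNReal.ofReal (b ^ ε / ε) + 2 * ENNReal.ofReal (b ^ ε / ε)) := by
        gcongr
        · rw [lintegral_indicator measurableSet_Ioo, lintegral_abs_sub_rpow_left c hb hq, hq']
        · rw [lintegral_indicator measurableSet_Ioo]
          simpa only [hq'] using lintegral_abs_sub_rpow_ball_le z hb hq
    _ = _ := by
        have h3 : p / ε = 2 * p / (1 - β) := by rw [hε_def]; field_simp
        rw [← h3, ENNReal.ofReal_mul hK, ENNReal.ofReal_mul (by norm_num : (0 : ℝ) ≤ 3)]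
        congr 1
        rw [ENNReal.ofReal_ofNat]
        ring

lemma sqrt_log_ge {n : ℕ} (hn : 10 ^ 9 ≤ n) : 4.55 ≤ Real.sqrt (Real.log n) := by
  refine Real.le_sqrt_of_sq_le ?_
  have h : Real.log ((10 : ℝ) ^ 9) ≤ Real.log n :=
    Real.log_le_log (by norm_num) (by exact_mod_cast hn)
  rw [Real.log_pow, Real.log_ten_eq] at h
  norm_num at h ⊢
  linarith [Real.log_two_gt_d9, Real.log_five_gt_d9]

lemma sq_sqrt_log (n : ℕ) : Real.sqrt (Real.log n) ^ 2 = Real.log n :=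
  Real.sq_sqrt (Real.log_natCast_nonneg n)

lemma one_sub_bet (n : ℕ) :
    1 - bet n = (Real.sqrt (Real.log n) ^ 2 + 3 / 2 * Real.sqrt (Real.log n)) /
      Real.exp (Real.sqrt (Real.log n)) := by
  rw [bet, gseq, Real.log_exp, sq_sqrt_log, sub_sub_cancel]

lemma bet_lt_one {n : ℕ} (hn : 10 ^ 9 ≤ n) : bet n < 1 := by
  have hs := sqrt_log_ge hn
  have : 0 < 1 - bet n := by
    rw [one_sub_bet]
    positivity
  linarith

lemma bet_nonneg {n : ℕ} (hn : 10 ^ 9 ≤ n) : 0 ≤ bet n := by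
  have hs := sqrt_log_ge hn
  have : 1 - bet n ≤ 1 := by
    rw [one_sub_bet, div_le_one (Real.exp_pos _)]
    set s := Real.sqrt (Real.log n)
    have h := Real.sum_le_exp_of_nonneg (by linarith : 0 ≤ s) 4
    norm_num [Finset.sum_range_succ, Nat.factorial] at h
    nlinarith [mul_nonneg (by linarith : (0 : ℝ) ≤ s - 4.55) (sq_nonneg s)]
  linarith

lemma bseq_rpow (n : ℕ) (t : ℝ) :
    bseq n ^ (t * (1 - bet n)) =
      Real.exp (-(t * (Real.sqrt (Real.log n) ^ 2 + 3 / 2 * Real.sqrt (Real.log n)))) := by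
  rw [one_sub_bet, bseq, ← Real.exp_mul, gseq]
  congr 1
  field_simp

/-- The common mass of the two spikes of index `n`. -/
def spikeMass (n : ℕ) : ℝ := bseq n ^ (1 - bet n) / (1 - bet n)

lemma spikeMass_nonneg {n : ℕ} (hn : 10 ^ 9 ≤ n) : 0 ≤ spikeMass n :=
  div_nonneg (Real.rpow_nonneg (Real.exp_pos _).le _) (by linarith [bet_lt_one hn])

lemma spikeMass_le {n : ℕ} (hn : 10 ^ 9 ≤ n) :
    spikeMass n ≤ Real.exp (-(Real.sqrt (Real.log n) / 2)) / (n * Real.log n) := by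
  have hs := sqrt_log_ge hn
  have hn0 : (0 : ℝ) < n := by exact_mod_cast (by norm_num : 0 < 10 ^ 9).trans_le hn
  have hexp : (n : ℝ) = Real.exp (Real.sqrt (Real.log n) ^ 2) := by
    rw [sq_sqrt_log, Real.exp_log hn0]
  have h := bseq_rpow n 1
  rw [one_mul, one_mul] at h
  rw [spikeMass, h, one_sub_bet]
  have hL := sq_sqrt_log n
  set s := Real.sqrt (Real.log n)
  rw [hexp, Real.log_exp, div_div_eq_mul_div, ← Real.exp_add,
    div_le_div_iff₀ (by positivity) (by positivity), ← mul_assoc, ← Real.exp_add]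
  have : -(s ^ 2 + 3 / 2 * s) + s + s ^ 2 = -(s / 2) := by ring
  rw [this]
  exact mul_le_mul_of_nonneg_left (by linarith) (Real.exp_pos _).le

lemma rpow_le_mul_exp_half {s q : ℝ} (hs : 0 ≤ s) (hq : 0 < q) :
    s ^ q ≤ (2 * q) ^ q * Real.exp (s / 2) := by
  have h1 : s ≤ 2 * q * Real.exp (s / (2 * q)) := by
    have := Real.add_one_le_exp (s / (2 * q))
    calc s = 2 * q * (s / (2 * q)) := by field_simp
      _ ≤ _ := mul_le_mul_of_nonneg_left (by linarith) (by positivity)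
  calc s ^ q ≤ (2 * q * Real.exp (s / (2 * q))) ^ q := Real.rpow_le_rpow hs h1 hq.le
    _ = _ := by
      rw [Real.mul_rpow (by positivity) (Real.exp_pos _).le, ← Real.exp_mul]
      congr 2
      field_simp

lemma one_div_mul_log_sq_le_aseq_sub {n : ℕ} (hn : 2 ≤ n) :
    1 / ((n + 1 : ℕ) * Real.log (n + 1 : ℕ) ^ 2) ≤ aseq n - aseq (n + 1) := by
  have hn0 : (0 : ℝ) < n := by positivity
  have hB : 0 < Real.log n := Real.log_pos (by exact_mod_cast hn)
  have hAB : Real.log n ≤ Real.log (n + 1 : ℕ) :=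
    Real.log_le_log hn0 (by push_cast; linarith)
  have hdiff : 1 / ((n + 1 : ℕ) : ℝ) ≤ Real.log (n + 1 : ℕ) - Real.log n := by
    have h := Real.one_sub_inv_le_log_of_pos (show (0 : ℝ) < (n + 1 : ℕ) / n by positivity)
    rw [Real.log_div (by positivity) hn0.ne'] at h
    refine le_trans (le_of_eq ?_) h
    push_cast
    field_simp
    ring
  have hA := hB.trans_le hAB
  have hN : (0 : ℝ) < (n + 1 : ℕ) := by positivity
  rw [aseq, aseq, div_sub_div _ _ hB.ne' hA.ne', one_mul, mul_one]
  calc 1 / (((n + 1 : ℕ) : ℝ) * Real.log (n + 1 : ℕ) ^ 2)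
      = (1 / ((n + 1 : ℕ) : ℝ)) / (Real.log (n + 1 : ℕ) * Real.log (n + 1 : ℕ)) := by
        rw [div_div, sq]
    _ ≤ _ := by
        gcongr

lemma summable_one_div_mul_log_sq : Summable fun n : ℕ => 1 / ((n : ℝ) * Real.log n ^ 2) := by
  rw [← summable_nat_add_iff 3]
  refine summable_of_sum_range_le (c := aseq 2) (fun n => by positivity) fun N => ?_
  calc ∑ i ∈ Finset.range N, 1 / (((i + 3 : ℕ) : ℝ) * Real.log (i + 3 : ℕ) ^ 2)
      ≤ ∑ i ∈ Finset.range N, (aseq (i + 2) - aseq (i + 1 + 2)) :=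
        Finset.sum_le_sum fun i _ => one_div_mul_log_sq_le_aseq_sub (n := i + 2) (by omega)
    _ = aseq (0 + 2) - aseq (N + 2) := Finset.sum_range_sub' (fun i => aseq (i + 2)) N
    _ ≤ aseq 2 := by
        have : 0 ≤ aseq (N + 2) := one_div_nonneg.2 (Real.log_natCast_nonneg _)
        simpa using this

/-- Every logarithmic moment of the sequence of masses is summable. -/
lemma summable_spikeMass_mul_log {p : ℝ} (hp : 0 ≤ p) :
    Summable fun n : ℕ =>
      if 10 ^ 9 ≤ n then 2 * (spikeMass n * (2 * Real.log n) ^ p) else 0 := by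
  set K : ℝ := 2 * (2 ^ p * (2 * (2 * p + 2)) ^ (2 * p + 2)) with hK
  have hK0 : 0 ≤ K := by positivity
  refine Summable.of_nonneg_of_le (fun n => ?_) (fun n => ?_)
    (summable_one_div_mul_log_sq.mul_left K)
  · split_ifs with hn
    · have := spikeMass_nonneg hn
      have := Real.log_natCast_nonneg n
      positivity
    · rfl
  · split_ifs with hn
    · have hs := sqrt_log_ge hn
      have hn0 : (0 : ℝ) < n := by exact_mod_cast (by norm_num : 0 < 10 ^ 9).trans_le hn
      have hm := spikeMass_le hn
      have hL := sq_sqrt_log n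
      set s := Real.sqrt (Real.log n) with hs_def
      have hs0 : 0 < s := by linarith
      rw [← hL] at hm ⊢
      have hpow : (2 * s ^ 2) ^ p * s ^ 2 = 2 ^ p * s ^ (2 * p + 2) := by
        rw [Real.mul_rpow (by norm_num) (by positivity), Real.rpow_add hs0, Real.rpow_mul hs0.le,
          Real.rpow_two, mul_assoc]
      have hle := rpow_le_mul_exp_half hs0.le (show 0 < 2 * p + 2 by linarith)
      calc 2 * (spikeMass n * (2 * s ^ 2) ^ p)
          ≤ 2 * (Real.exp (-(s / 2)) / (n * s ^ 2) * (2 * s ^ 2) ^ p) := by gcongr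
        _ = 2 * (Real.exp (-(s / 2)) * ((2 * s ^ 2) ^ p * s ^ 2)) * (1 / (n * (s ^ 2) ^ 2)) := by
            field_simp
        _ ≤ K * (1 / (n * (s ^ 2) ^ 2)) := by
            refine mul_le_mul_of_nonneg_right ?_ (by positivity)
            rw [hpow, hK]
            refine mul_le_mul_of_nonneg_left ?_ (by norm_num)
            calc Real.exp (-(s / 2)) * (2 ^ p * s ^ (2 * p + 2))
                ≤ Real.exp (-(s / 2)) *
                  (2 ^ p * ((2 * (2 * p + 2)) ^ (2 * p + 2) * Real.exp (s / 2))) := by gcongr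
              _ = 2 ^ p * (2 * (2 * p + 2)) ^ (2 * p + 2) *
                  (Real.exp (-(s / 2)) * Real.exp (s / 2)) := by ring
              _ = _ := by rw [← Real.exp_add, neg_add_cancel, Real.exp_zero, mul_one]
    · positivity

/-- The uniform bound of `lintegral_spike_mul_log_le` stays bounded along the sequence. -/
lemma spike_log_bound_le {n : ℕ} (hn : 10 ^ 9 ≤ n) {p : ℝ} (hp : 0 < p) :
    (2 * p / (1 - bet n)) ^ p *
        (3 * (bseq n ^ ((1 - bet n) / 2) / ((1 - bet n) / 2))) ≤
      (2 * p) ^ p * (6 * Real.exp ((p + 1) ^ 2 / 2)) := by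
  have hs := sqrt_log_ge hn
  have hr : 0 < 1 - bet n := by linarith [bet_lt_one hn]
  have hb := bseq_rpow n (1 / 2)
  have hinv : 1 / (1 - bet n) ≤ Real.exp (Real.sqrt (Real.log n)) := by
    rw [one_sub_bet, one_div_div]
    refine div_le_self (Real.exp_pos _).le ?_
    nlinarith
  rw [div_eq_inv_mul (1 - bet n) 2, ← one_div, hb]
  set s := Real.sqrt (Real.log n)
  set r := 1 - bet n
  have h1 : Real.exp (-(1 / 2 * (s ^ 2 + 3 / 2 * s))) ≤ Real.exp (-(s ^ 2 / 2)) :=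
    Real.exp_le_exp.2 (by nlinarith)
  calc (2 * p / r) ^ p * (3 * (Real.exp (-(1 / 2 * (s ^ 2 + 3 / 2 * s))) / (1 / 2 * r)))
      = (2 * p * (1 / r)) ^ p *
          (6 * (Real.exp (-(1 / 2 * (s ^ 2 + 3 / 2 * s))) * (1 / r))) := by
        rw [mul_one_div (2 * p)]
        field_simp
        norm_num
    _ ≤ (2 * p * Real.exp s) ^ p * (6 * (Real.exp (-(s ^ 2 / 2)) * Real.exp s)) := by gcongr
    _ = (2 * p) ^ p * (6 * Real.exp (s * p + (-(s ^ 2 / 2) + s))) := by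
        rw [Real.mul_rpow (by positivity) (Real.exp_pos _).le, ← Real.exp_mul, ← Real.exp_add,
          Real.exp_add (s * p)]
        ring
    _ ≤ _ := by
        gcongr
        nlinarith [sq_nonneg (s - (p + 1))]

lemma gseq_rpow_quarter (n : ℕ) :
    gseq n ^ ((1 : ℝ) / 4) = Real.exp (Real.sqrt (Real.log n) / 4) := by
  rw [gseq, ← Real.exp_mul]
  ring_nf

lemma bseq_le_dlt (n : ℕ) : bseq n ≤ dlt n := by
  rw [bseq, dlt, gseq_rpow_quarter, gseq]
  refine Real.exp_le_exp.2 (neg_le_neg (Real.exp_le_exp.2 ?_))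
  linarith [Real.sqrt_nonneg (Real.log n)]

lemma two_mul_log_add_le_exp {s : ℝ} (hs : 4.55 ≤ s) :
    2 * Real.log s + 1 / 50 ≤ Real.exp (s / 4) := by
  have h1 : (3.1 : ℝ) ≤ Real.exp (4.55 / 4) := by
    have h := Real.sum_le_exp_of_nonneg (x := 4.55 / 4) (by norm_num) 6
    norm_num [Finset.sum_range_succ, Nat.factorial] at h ⊢
    linarith
  have h2 : Real.log 4.55 ≤ 1.52 := by
    rw [Real.log_le_iff_le_exp (by norm_num)]
    have h := Real.sum_le_exp_of_nonneg (x := 1.52) (by norm_num) 7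
    norm_num [Finset.sum_range_succ, Nat.factorial] at h ⊢
    linarith
  have h3 : Real.log s ≤ 1.52 + (s - 4.55) / 4.55 := by
    have h := Real.log_le_sub_one_of_pos (show 0 < s / 4.55 by positivity)
    rw [Real.log_div (by linarith) (by norm_num)] at h
    have : s / 4.55 - 1 = (s - 4.55) / 4.55 := by field_simp
    linarith
  have h4 : 3.1 * (1 + (s - 4.55) / 4) ≤ Real.exp (s / 4) := by
    have h := Real.add_one_le_exp ((s - 4.55) / 4)
    calc 3.1 * (1 + (s - 4.55) / 4) ≤ Real.exp (4.55 / 4) * Real.exp ((s - 4.55) / 4) :=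
          mul_le_mul h1 (by linarith) (by linarith) (Real.exp_pos _).le
      _ = Real.exp (s / 4) := by
          rw [← Real.exp_add]
          ring_nf
  norm_num at h3 h4 hs ⊢
  linarith

/-- The spikes of index `n` lie in the positive half-line. -/
lemma dlt_add_bseq_le_aseq {n : ℕ} (hn : 10 ^ 9 ≤ n) : dlt n + bseq n ≤ aseq n := by
  have hs := sqrt_log_ge hn
  have hlog := two_mul_log_add_le_exp hs
  rw [dlt, bseq, aseq, gseq_rpow_quarter, gseq]
  have hL := sq_sqrt_log n
  set s := Real.sqrt (Real.log n)
  rw [← hL]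
  have hs0 : 0 < s := by linarith
  have hy4 : Real.exp s = Real.exp (s / 4) ^ 4 := by
    rw [← Real.exp_nat_mul]
    congr 1
    push_cast
    ring
  rw [hy4]
  have hy : 11 / 4 ≤ Real.exp (s / 4) := by
    have h := Real.quadratic_le_exp_of_nonneg (show 0 ≤ s / 4 by linarith)
    norm_num at hs
    nlinarith
  have hsq : 1 / s ^ 2 = Real.exp (-(2 * Real.log s)) := by
    rw [Real.exp_neg, two_mul, Real.exp_add, Real.exp_log hs0, one_div, sq]
  rw [hsq]
  set y := Real.exp (s / 4)
  have hcube : (11 / 4 : ℝ) ^ 3 ≤ y ^ 3 := pow_le_pow_left₀ (by norm_num) hy 3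
  have hgap : 49 ≤ y ^ 4 - y := by
    norm_num at hcube
    nlinarith
  have hsmall : Real.exp (-(y ^ 4)) ≤ Real.exp (-y) * (1 / 50) := by
    have : Real.exp (-(y ^ 4)) = Real.exp (-y) * Real.exp (-(y ^ 4 - y)) := by
      rw [← Real.exp_add]
      ring_nf
    rw [this]
    refine mul_le_mul_of_nonneg_left ?_ (Real.exp_pos _).le
    rw [Real.exp_neg, ← one_div]
    exact one_div_le_one_div_of_le (by norm_num) (by linarith [Real.add_one_le_exp (y ^ 4 - y)])
  calc Real.exp (-y) + Real.exp (-(y ^ 4)) ≤ Real.exp (-y) * (1 / 50 + 1) := by linarith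
    _ ≤ Real.exp (-y) * Real.exp (1 / 50) :=
        mul_le_mul_of_nonneg_left (Real.add_one_le_exp _) (Real.exp_pos _).le
    _ = Real.exp (-y + 1 / 50) := (Real.exp_add _ _).symm
    _ ≤ _ := Real.exp_le_exp.2 (by linarith)

lemma aseq_le_half {n : ℕ} (hn : 10 ^ 9 ≤ n) : aseq n ≤ 1 / 2 := by
  have hs := sqrt_log_ge hn
  have hL := sq_sqrt_log n
  refine one_div_le_one_div_of_le (by norm_num) ?_
  norm_num at hs
  nlinarith

lemma aseq_antitone {m n : ℕ} (hm : 2 ≤ m) (hmn : m ≤ n) : aseq n ≤ aseq m :=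
  one_div_le_one_div_of_le (Real.log_pos (by exact_mod_cast hm))
    (Real.log_le_log (by positivity) (by exact_mod_cast hmn))

lemma eventually_dlt_le : ∀ᶠ n : ℕ in Filter.atTop, dlt n ≤ 1 / (n : ℝ) ^ 2 := by
  have hs : Filter.Tendsto (fun n : ℕ => Real.sqrt (Real.log n)) Filter.atTop Filter.atTop :=
    Real.tendsto_sqrt_atTop.comp (Real.tendsto_log_atTop.comp tendsto_natCast_atTop_atTop)
  have ho := (isLittleO_pow_exp_pos_mul_atTop 2 (show (0 : ℝ) < 1 / 4 by norm_num)).bound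
    (show (0 : ℝ) < 1 / 2 by norm_num)
  filter_upwards [hs.eventually ho, Filter.eventually_gt_atTop 0] with n h hn
  have hn0 : (0 : ℝ) < n := by exact_mod_cast hn
  rw [Real.norm_of_nonneg (sq_nonneg _), Real.norm_of_nonneg (Real.exp_pos _).le, sq_sqrt_log] at h
  rw [dlt, gseq_rpow_quarter, one_div, ← Real.exp_log (pow_pos hn0 2), ← Real.exp_neg, Real.log_pow]
  refine Real.exp_le_exp.2 (neg_le_neg ?_)
  rw [div_eq_inv_mul, ← one_div]
  push_cast
  linarith

lemma eventually_lt_aseq_sub :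
    ∀ᶠ n : ℕ in Filter.atTop, 6 / (n : ℝ) ^ 2 < aseq n - aseq (n + 1) := by
  have hlim : Filter.Tendsto (fun n : ℕ => ((n + 1 : ℕ) : ℝ)) Filter.atTop Filter.atTop :=
    tendsto_natCast_atTop_atTop.comp (Filter.tendsto_add_atTop_nat 1)
  have ho := (Real.isLittleO_pow_log_id_atTop (n := 2)).bound
    (show (0 : ℝ) < 1 / 48 by norm_num)
  filter_upwards [hlim.eventually ho, Filter.eventually_ge_atTop 2] with n h hn
  refine lt_of_lt_of_le ?_ (one_div_mul_log_sq_le_aseq_sub hn)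
  have hn2 : (2 : ℝ) ≤ n := by exact_mod_cast hn
  have hN : (0 : ℝ) < (n + 1 : ℕ) := by positivity
  have hA : 0 < Real.log (n + 1 : ℕ) := Real.log_pos (by push_cast; linarith)
  rw [Real.norm_of_nonneg (sq_nonneg _), id, Real.norm_of_nonneg hN.le] at h
  rw [div_lt_div_iff₀ (by positivity) (by positivity)]
  have h2 := mul_le_mul_of_nonneg_left h hN.le
  push_cast at h2 ⊢
  nlinarith

/-- The `n`-th term of the series defining `Omt`. -/
def OmtTerm (n : ℕ) (x : ℝ) : ℝ :=
  if 10 ^ 9 ≤ n then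
    spike (cseq n) (bseq n) (bet n) x - spike (dseq n) (bseq n) (bet n) x
  else 0

lemma Omt_eq_tsum (x : ℝ) : Omt x = ∑' n, OmtTerm n x := rfl

lemma measurable_OmtTerm (n : ℕ) : Measurable (OmtTerm n) := by
  unfold OmtTerm
  split_ifs
  · exact (measurable_spike _ _ _).sub (measurable_spike _ _ _)
  · exact measurable_const

lemma measurable_Omt : Measurable Omt :=
  Measurable.tsum measurable_OmtTerm

/-- A weighted integral of `|Omt|` is at most the sum of the weighted integrals of its spikes. -/
lemma setLIntegral_Omt_mul_le (s : Set ℝ) {w : ℝ → ℝ} (hw : Measurable w) :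
    ∫⁻ x in s, ENNReal.ofReal (|Omt x| * w x) ≤
      ∑' n : ℕ, if 10 ^ 9 ≤ n then
        (∫⁻ x in s, ENNReal.ofReal (spike (cseq n) (bseq n) (bet n) x * w x)) +
          ∫⁻ x in s, ENNReal.ofReal (spike (dseq n) (bseq n) (bet n) x * w x)
      else 0 := by
  calc ∫⁻ x in s, ENNReal.ofReal (|Omt x| * w x)
      ≤ ∫⁻ x in s, ∑' n, ‖OmtTerm n x‖ₑ * ENNReal.ofReal (w x) := by
        refine lintegral_mono fun x => ?_
        rw [ENNReal.ofReal_mul (abs_nonneg _), ← Real.enorm_eq_ofReal_abs, Omt_eq_tsum,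
          ENNReal.tsum_mul_right]
        exact mul_le_mul_left enorm_tsum_le_tsum_enorm _
    _ = ∑' n, ∫⁻ x in s, ‖OmtTerm n x‖ₑ * ENNReal.ofReal (w x) :=
        lintegral_tsum fun n =>
          ((measurable_OmtTerm n).enorm.mul hw.ennreal_ofReal).aemeasurable
    _ ≤ _ := by
        refine ENNReal.tsum_le_tsum fun n => ?_
        unfold OmtTerm
        split_ifs with hn
        · have hm := ((measurable_spike (cseq n) (bseq n) (bet n)).mul hw).ennreal_ofReal
          simp only [Pi.mul_apply] at hm
          rw [← lintegral_add_left hm]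
          refine lintegral_mono fun x => ?_
          rw [ENNReal.ofReal_mul (spike_nonneg _ _ _ _), ENNReal.ofReal_mul (spike_nonneg _ _ _ _),
            ← add_mul]
          refine mul_le_mul_left ((enorm_sub_le).trans (le_of_eq ?_)) _
          rw [Real.enorm_of_nonneg (spike_nonneg _ _ _ _),
            Real.enorm_of_nonneg (spike_nonneg _ _ _ _)]
        · simp

lemma integrable_OmtTerm (n : ℕ) : Integrable (OmtTerm n) := by
  unfold OmtTerm
  split_ifs with hn
  · exact (integrable_spike _ (Real.exp_pos _).le (bet_lt_one hn)).sub
      (integrable_spike _ (Real.exp_pos _).le (bet_lt_one hn))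
  · exact integrable_zero _ _ _

lemma setIntegral_OmtTerm (n : ℕ) : ∫ x in Set.Icc (0 : ℝ) 1, OmtTerm n x = 0 := by
  unfold OmtTerm
  split_ifs with hn
  · have hb : 0 < bseq n := Real.exp_pos _
    have hd : 0 < dlt n := Real.exp_pos _
    have hβ := bet_lt_one hn
    have hle := dlt_add_bseq_le_aseq hn
    have ha := aseq_le_half hn
    rw [integral_sub (integrable_spike _ hb.le hβ).integrableOn
      (integrable_spike _ hb.le hβ).integrableOn,
      setIntegral_Icc_spike hb.le hβ (by rw [cseq]; linarith) (by rw [cseq]; linarith),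
      setIntegral_Icc_spike hb.le hβ (by rw [dseq]; linarith) (by rw [dseq]; linarith), sub_self]
  · simp

lemma integrable_Omt : Integrable Omt := by
  refine ⟨measurable_Omt.aestronglyMeasurable, ?_⟩
  have h := setLIntegral_Omt_mul_le Set.univ (w := fun _ => 1) measurable_const
  simp only [mul_one, Measure.restrict_univ] at h
  rw [hasFiniteIntegral_iff_norm]
  refine h.trans_lt (lt_of_le_of_lt (ENNReal.tsum_le_tsum fun n => ?_)
    (summable_spikeMass_mul_log le_rfl).tsum_ofReal_lt_top)
  split_ifs with hn
  · have hb : 0 ≤ bseq n := (Real.exp_pos _).le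
    rw [lintegral_spike _ hb (bet_lt_one hn), lintegral_spike _ hb (bet_lt_one hn), Real.rpow_zero, mul_one,
      ← two_mul, ENNReal.ofReal_mul zero_le_two, ENNReal.ofReal_ofNat, spikeMass]
  · simp

lemma integral_norm_OmtTerm_le (n : ℕ) :
    ∫ x in Set.Icc (0 : ℝ) 1, ‖OmtTerm n x‖ ≤
      if 10 ^ 9 ≤ n then 2 * (spikeMass n * (2 * Real.log n) ^ (0 : ℝ)) else 0 := by
  refine (setIntegral_le_integral (integrable_OmtTerm n).norm
    (Filter.Eventually.of_forall fun x => norm_nonneg _)).trans ?_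
  unfold OmtTerm
  split_ifs with hn
  · have hb : 0 ≤ bseq n := (Real.exp_pos _).le
    have hβ := bet_lt_one hn
    have hc := integrable_spike (cseq n) hb hβ
    have hd := integrable_spike (dseq n) hb hβ
    calc _ ≤ ∫ x, (spike (cseq n) (bseq n) (bet n) x + spike (dseq n) (bseq n) (bet n) x) := by
          refine integral_mono (hc.sub hd).norm (hc.add hd) fun x => (norm_sub_le _ _).trans ?_
          rw [Real.norm_of_nonneg (spike_nonneg _ _ _ _),
            Real.norm_of_nonneg (spike_nonneg _ _ _ _)]
      _ = _ := by
          rw [integral_add hc hd, integral_spike _ hb hβ, integral_spike _ hb hβ, Real.rpow_zero,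
            mul_one, two_mul, spikeMass]
  · simp

lemma setIntegral_Omt : ∫ x in Set.Icc (0 : ℝ) 1, Omt x = 0 := by
  have hsum : Summable fun n => ∫ x in Set.Icc (0 : ℝ) 1, ‖OmtTerm n x‖ :=
    Summable.of_nonneg_of_le (fun n => integral_nonneg fun x => norm_nonneg _)
      integral_norm_OmtTerm_le (summable_spikeMass_mul_log le_rfl)
  have h := integral_tsum_of_summable_integral_norm
    (fun n => (integrable_OmtTerm n).integrableOn (s := Set.Icc (0 : ℝ) 1)) hsum
  simp only [setIntegral_OmtTerm, tsum_zero] at h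
  exact h.symm

/-- All but boundedly many of the points `aseq n` are at distance at least `3 / n ^ 2` from any
given `z`. -/
lemma exists_unique_near_aseq :
    ∃ N : ℕ, (∀ n, N ≤ n → dlt n ≤ 1 / (n : ℝ) ^ 2) ∧
      ∀ z : ℝ, ∃ m : ℕ, ∀ n, N ≤ n → n ≠ m → 3 / (n : ℝ) ^ 2 ≤ |z - aseq n| := by
  obtain ⟨N, hN⟩ := Filter.eventually_atTop.1
    ((eventually_dlt_le.and eventually_lt_aseq_sub).and (Filter.eventually_ge_atTop 2))
  refine ⟨N, fun n hn => (hN n hn).1.1, fun z => ?_⟩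
  have hsep : ∀ m n, N ≤ m → m < n → |z - aseq m| < 3 / (m : ℝ) ^ 2 →
      3 / (n : ℝ) ^ 2 ≤ |z - aseq n| := by
    intro m n hm hmn hzm
    by_contra! hzn
    have hm2 := (hN m hm).2
    have hanti := aseq_antitone (m := m + 1) (by omega) hmn
    have hgap := (hN m hm).1.2
    have hpow : 3 / (n : ℝ) ^ 2 ≤ 3 / (m : ℝ) ^ 2 := by gcongr
    have htwo : 6 / (m : ℝ) ^ 2 = 3 / (m : ℝ) ^ 2 + 3 / (m : ℝ) ^ 2 := by ring
    linarith [(abs_lt.1 hzm).1, (abs_lt.1 hzn).2]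
  by_cases h : ∃ m, N ≤ m ∧ |z - aseq m| < 3 / (m : ℝ) ^ 2
  · obtain ⟨m, hm, hzm⟩ := h
    refine ⟨m, fun n hn hnm => ?_⟩
    rcases hnm.lt_or_gt with hlt | hlt
    · by_contra! hzn
      exact absurd hzm (not_lt.2 (hsep n m hn hlt hzn))
    · exact hsep m n hm hlt hzm
  · push Not at h
    exact ⟨0, fun n hn _ => h n hn⟩

/-- Away from the singular point the logarithmic weight only costs a power of `log n`. -/
lemma log_weight_le {n : ℕ} {p x z : ℝ} (hn : 10 ^ 9 ≤ n) (hp : 0 < p)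
    (hδ : dlt n ≤ 1 / (n : ℝ) ^ 2) (hz : 3 / (n : ℝ) ^ 2 ≤ |z - aseq n|)
    (hxz : |x - z| ≤ 1) (hx : |x - aseq n| ≤ dlt n + bseq n) :
    Real.log (1 / |x - z|) ^ p ≤ (2 * Real.log n) ^ p := by
  have hn0 : (0 : ℝ) < n := by exact_mod_cast (by norm_num : 0 < 10 ^ 9).trans_le hn
  have hdist : 1 / (n : ℝ) ^ 2 ≤ |x - z| := by
    have htri := abs_sub_le z x (aseq n)
    rw [abs_sub_comm z x] at htri
    have hb := bseq_le_dlt n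
    have hthree : 3 / (n : ℝ) ^ 2 = 1 / (n : ℝ) ^ 2 + 1 / (n : ℝ) ^ 2 + 1 / (n : ℝ) ^ 2 := by ring
    linarith
  have hpos : 0 < |x - z| := lt_of_lt_of_le (by positivity) hdist
  refine Real.rpow_le_rpow (Real.log_nonneg ((one_le_div hpos).2 hxz)) ?_ hp.le
  have h2 : 2 * Real.log n = Real.log ((n : ℝ) ^ 2) := by
    rw [Real.log_pow]
    norm_num
  rw [h2]
  refine Real.log_le_log (by positivity) ?_
  rwa [one_div_le hpos (by positivity)]

lemma exists_lintegral_Omt_mul_log_le {p : ℝ} (hp : 0 < p) :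
    ∃ C : ℝ, ∀ z ∈ Set.Icc (0 : ℝ) 1,
      ∫⁻ x in Set.Icc (0 : ℝ) 1, ENNReal.ofReal (|Omt x| * Real.log (1 / |x - z|) ^ p) ≤
        ENNReal.ofReal C := by
  obtain ⟨N, hδ, hnear⟩ := exists_unique_near_aseq
  set g : ℕ → ℝ := fun n =>
    if 10 ^ 9 ≤ n then 2 * (spikeMass n * (2 * Real.log n) ^ p) else 0 with hg_def
  have hg : Summable g := summable_spikeMass_mul_log hp.le
  have hg0 : ∀ n, 0 ≤ g n := by
    intro n
    simp only [hg_def]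
    split_ifs with hn
    · have := spikeMass_nonneg hn
      have := Real.log_natCast_nonneg n
      positivity
    · rfl
  set K : ℝ := (2 * p) ^ p * (6 * Real.exp ((p + 1) ^ 2 / 2)) with hK_def
  have hK : 0 ≤ K := by positivity
  refine ⟨∑' n, g n + (N + 1) * (2 * K), fun z hz => ?_⟩
  obtain ⟨m, hm⟩ := hnear z
  set F : Finset ℕ := insert m (Finset.range N) with hF
  have hw : Measurable fun x : ℝ => Real.log (1 / |x - z|) ^ p := by fun_prop
  have hterm : ∀ n : ℕ, (if 10 ^ 9 ≤ n then
        (∫⁻ x in Set.Icc (0 : ℝ) 1, ENNReal.ofReal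
          (spike (cseq n) (bseq n) (bet n) x * Real.log (1 / |x - z|) ^ p)) +
        ∫⁻ x in Set.Icc (0 : ℝ) 1, ENNReal.ofReal
          (spike (dseq n) (bseq n) (bet n) x * Real.log (1 / |x - z|) ^ p)
      else 0) ≤ ENNReal.ofReal (g n) + if n ∈ F then ENNReal.ofReal (2 * K) else 0 := by
    intro n
    split_ifs with hn hnF hnF
    · refine le_add_left ?_
      have hbd : ∀ c : ℝ, ∫⁻ x in Set.Icc (0 : ℝ) 1, ENNReal.ofReal
          (spike c (bseq n) (bet n) x * Real.log (1 / |x - z|) ^ p) ≤ ENNReal.ofReal K := fun c =>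
        (lintegral_spike_mul_log_le (Real.exp_pos _).le (bet_nonneg hn) (bet_lt_one hn) hp hz).trans
          (ENNReal.ofReal_le_ofReal (spike_log_bound_le hn hp))
      rw [two_mul, ENNReal.ofReal_add hK hK]
      exact add_le_add (hbd _) (hbd _)
    · rw [add_zero]
      have hnN : N ≤ n := by
        by_contra! h
        exact hnF (Finset.mem_insert_of_mem (Finset.mem_range.2 h))
      have hnm : n ≠ m := fun h => hnF (h ▸ Finset.mem_insert_self _ _)
      have hd0 : 0 < dlt n := Real.exp_pos _
      have hb0 : 0 < bseq n := Real.exp_pos _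
      have hbd : ∀ c : ℝ, |c - aseq n| = dlt n →
          ∫⁻ x in Set.Icc (0 : ℝ) 1, ENNReal.ofReal
            (spike c (bseq n) (bet n) x * Real.log (1 / |x - z|) ^ p) ≤
          ENNReal.ofReal (spikeMass n * (2 * Real.log n) ^ p) := by
        intro c hc
        refine setLIntegral_spike_mul_le _ hb0.le (bet_lt_one hn) measurableSet_Icc
          fun x hx01 hx => log_weight_le hn hp (hδ n hnN) (hm n hnN hnm)
            (abs_le.2 ⟨by linarith [hx01.1, hz.2], by linarith [hx01.2, hz.1]⟩) ?_
        have hxc : |x - c| ≤ bseq n := abs_le.2 ⟨by linarith [hx.1], by linarith [hx.2]⟩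
        linarith [abs_sub_le x c (aseq n)]
      have hmass : 0 ≤ spikeMass n * (2 * Real.log n) ^ p := by
        have := spikeMass_nonneg hn
        have := Real.log_natCast_nonneg n
        positivity
      simp only [hg_def, if_pos hn]
      rw [two_mul, ENNReal.ofReal_add hmass hmass]
      exact add_le_add (hbd _ (by rw [cseq, sub_sub_cancel_left, abs_neg, abs_of_pos hd0]))
        (hbd _ (by rw [dseq, add_sub_cancel_left, abs_of_pos hd0]))
    · simp
    · simp
  calc _ ≤ ∑' n, (ENNReal.ofReal (g n) + if n ∈ F then ENNReal.ofReal (2 * K) else 0) :=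
        (setLIntegral_Omt_mul_le _ hw).trans (ENNReal.tsum_le_tsum hterm)
    _ = ENNReal.ofReal (∑' n, g n) + F.card * ENNReal.ofReal (2 * K) := by
        rw [ENNReal.tsum_add, ENNReal.ofReal_tsum_of_nonneg hg0 hg,
          tsum_eq_sum (s := F) (fun n hn => if_neg hn), Finset.sum_congr rfl
            (fun n hn => if_pos hn), Finset.sum_const, nsmul_eq_mul]
    _ ≤ ENNReal.ofReal (∑' n, g n) + ENNReal.ofReal (N + 1) * ENNReal.ofReal (2 * K) := by
        gcongr
        have hcard : F.card ≤ N + 1 := (Finset.card_insert_le _ _).trans (by simp)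
        rw [← ENNReal.ofReal_natCast]
        exact ENNReal.ofReal_le_ofReal (by exact_mod_cast hcard)
    _ = _ := by
        rw [← ENNReal.ofReal_mul (by positivity), ← ENNReal.ofReal_add (tsum_nonneg hg0)
          (by positivity)]

theorem Omt_integrable_meanZero_logCondition :
    IntegrableOn Omt (Set.Icc (0 : ℝ) 1) volume ∧
    (∫ x in Set.Icc (0 : ℝ) 1, Omt x) = 0 ∧
    ∀ α : ℝ, 0 < α → ∃ C : ℝ, ∀ z ∈ Set.Icc (0 : ℝ) 1,
      ∫⁻ x in Set.Icc (0 : ℝ) 1,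
        ENNReal.ofReal (|Omt x| * (Real.log (1 / |x - z|)) ^ (1 + α)) ≤ ENNReal.ofReal C :=
  ⟨integrable_Omt.integrableOn, setIntegral_Omt,
    fun _ hα => exists_lintegral_Omt_mul_log_le (by linarith)⟩
end
end

section
/- For integers n ≥ 10⁹ define a_n = 1/ln n, γ_n = e^{(ln n)^{1/2}}, b_n = e^{−γ_n}, β_n = 1 − (ln n + (3/2) ln γ_n)/γ_n. Then for every α > 0 there exists a constant C_α > 0 such that sup_{N ≥ 10⁹} Σ_{n ≥ 10⁹, n ≠ N} (b_n^{1−β_n}/(1−β_n)) (ln(1/|a_n − a_N|))^{1+α} ≤ C_α. -/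
open MeasureTheory Metric
open scoped ENNReal

noncomputable section

/-- The series `∑ 1 / (n (ln n)²)` converges. -/
lemma summable_one_div_nat_mul_log_sq :
    Summable fun n : ℕ ↦ 1 / ((n : ℝ) * Real.log n ^ 2) := by
  rw [← summable_condensed_iff_of_eventually_nonneg]
  · have h : (fun k : ℕ ↦ (2 : ℝ) ^ k * (1 / (((2 ^ k : ℕ) : ℝ) * Real.log ((2 ^ k : ℕ) : ℝ) ^ 2)))
        = fun k : ℕ ↦ (1 / Real.log 2 ^ 2) * (1 / (k : ℝ) ^ 2) := by
      funext k
      push_cast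
      rw [Real.log_pow, mul_pow]
      have h2 : (2 : ℝ) ^ k ≠ 0 := by positivity
      rw [mul_one_div, div_mul_cancel_left₀ h2, mul_inv, one_div, one_div, mul_comm]
    rw [h]
    exact (Real.summable_one_div_nat_pow.2 one_lt_two).mul_left _
  · exact Filter.Eventually.of_forall fun n ↦ by positivity
  · filter_upwards [Filter.eventually_ge_atTop 2] with n hn
    have hn' : (2 : ℝ) ≤ n := by exact_mod_cast hn
    have hlog : 0 < Real.log n := Real.log_pos (by linarith)
    have hmono : Real.log n ≤ Real.log ((n + 1 : ℕ) : ℝ) :=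
      Real.log_le_log (by linarith) (by push_cast; linarith)
    push_cast at hmono ⊢
    gcongr
    linarith

lemma one_le_log_natCast {n : ℕ} (hn : 3 ≤ n) : 1 ≤ Real.log n := by
  rw [Real.le_log_iff_exp_le (by positivity)]
  have h : (3 : ℝ) ≤ n := by exact_mod_cast hn
  linarith [Real.exp_one_lt_d9]

lemma one_div_le_log_sub_log {m k : ℕ} (hm : 0 < m) (hmk : m < k) :
    1 / (k : ℝ) ≤ Real.log k - Real.log m := by
  have hm' : (0 : ℝ) < m := by exact_mod_cast hm
  have hk : (m : ℝ) + 1 ≤ k := by exact_mod_cast hmk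
  have hk' : (0 : ℝ) < k := by linarith
  rw [← Real.log_div hk'.ne' hm'.ne']
  refine le_trans ?_ (Real.one_sub_inv_le_log_of_pos (div_pos hk' hm'))
  rw [inv_div, div_le_iff₀ hk', sub_mul, div_mul_cancel₀ _ hk'.ne']
  linarith

lemma one_div_sq_le_abs_log_sub_log {m n : ℕ} (hm : 0 < m) (hn : 0 < n) (hne : n ≠ m)
    (hmn : m ≤ n ^ 2) : 1 / (n : ℝ) ^ 2 ≤ |Real.log m - Real.log n| := by
  have hm' : (0 : ℝ) < m := by exact_mod_cast hm
  have hn' : (1 : ℝ) ≤ n := by exact_mod_cast hn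
  rcases hne.lt_or_gt with h | h
  · calc 1 / (n : ℝ) ^ 2 ≤ 1 / m := one_div_le_one_div_of_le hm' (by exact_mod_cast hmn)
      _ ≤ _ := (one_div_le_log_sub_log hn h).trans (le_abs_self _)
  · calc 1 / (n : ℝ) ^ 2 ≤ 1 / n := one_div_le_one_div_of_le (by linarith) (by nlinarith)
      _ ≤ _ := (one_div_le_log_sub_log hm h).trans (by rw [abs_sub_comm]; exact le_abs_self _)

/-- The gap `|a_n - a_N|` is at least `n⁻⁵`, uniformly in `N`. -/
lemma one_div_abs_aseq_sub_le {n N : ℕ} (hn : 3 ≤ n) (hN : 3 ≤ N) (hne : n ≠ N) :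
    1 / |aseq n - aseq N| ≤ (n : ℝ) ^ 5 := by
  have hL := one_le_log_natCast hn
  have hM := one_le_log_natCast hN
  have hn3 : (3 : ℝ) ≤ n := by exact_mod_cast hn
  have hn0 : (0 : ℝ) < n := by linarith
  have hLn : Real.log n ≤ n := Real.log_le_self hn0.le
  have hgap : |aseq n - aseq N| =
      |Real.log N - Real.log n| / (Real.log n * Real.log N) := by
    rw [aseq, aseq, div_sub_div _ _ (by positivity) (by positivity), one_mul, mul_one, abs_div,
      abs_of_pos (a := Real.log n * Real.log N) (by positivity)]
  rw [hgap, one_div_div]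
  rcases le_or_gt N (n ^ 2) with h | h
  · have hd := one_div_sq_le_abs_log_sub_log (by lia) (by lia) hne h
    have hM2 : Real.log N ≤ (n : ℝ) ^ 2 :=
      (Real.log_le_self (by positivity)).trans (by exact_mod_cast h)
    have hd0 : 0 < |Real.log N - Real.log n| := lt_of_lt_of_le (by positivity) hd
    rw [div_le_iff₀ hd0]
    calc Real.log n * Real.log N ≤ n * n ^ 2 := by gcongr
      _ = n ^ 5 * (1 / n ^ 2) := by field_simp
      _ ≤ _ := by gcongr
  · have h2 : 2 * Real.log n ≤ Real.log N := by
      have hlog := Real.log_le_log (by positivity)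
        (show ((n : ℝ) ^ 2) ≤ N by exact_mod_cast h.le)
      rwa [Real.log_pow] at hlog
    rw [abs_of_pos (by linarith), div_le_iff₀ (by linarith)]
    have h5 : (2 : ℝ) * n ≤ n ^ 5 := by
      nlinarith [pow_le_pow_left₀ (by norm_num) hn3 4]
    calc Real.log n * Real.log N ≤ n * Real.log N := by gcongr
      _ ≤ n * (2 * (Real.log N - Real.log n)) := by gcongr; linarith
      _ = 2 * n * (Real.log N - Real.log n) := by ring
      _ ≤ _ := by gcongr; linarith

lemma log_one_div_abs_aseq_sub_le {n N : ℕ} (hn : 3 ≤ n) (hN : 3 ≤ N) (hne : n ≠ N) :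
    Real.log (1 / |aseq n - aseq N|) ≤ 5 * Real.log n := by
  rcases (abs_nonneg (aseq n - aseq N)).eq_or_lt with h | h
  · rw [← h, div_zero, Real.log_zero]
    linarith [one_le_log_natCast hn]
  · have hlog := Real.log_le_log (one_div_pos.2 h) (one_div_abs_aseq_sub_le hn hN hne)
    rwa [Real.log_pow] at hlog

lemma aseq_mem_Icc {n : ℕ} (hn : 3 ≤ n) : aseq n ∈ Set.Icc (0 : ℝ) 1 := by
  have hL := one_le_log_natCast hn
  refine ⟨by unfold aseq; positivity, ?_⟩
  rw [aseq, div_le_one (by linarith)]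
  exact hL

lemma log_one_div_abs_aseq_sub_nonneg {n N : ℕ} (hn : 3 ≤ n) (hN : 3 ≤ N) :
    0 ≤ Real.log (1 / |aseq n - aseq N|) := by
  rw [one_div, Real.log_inv, neg_nonneg]
  refine Real.log_nonpos (abs_nonneg _) (abs_le.2 ?_)
  have h1 := aseq_mem_Icc hn
  have h2 := aseq_mem_Icc hN
  constructor <;> linarith [h1.1, h1.2, h2.1, h2.2]

/-- The weight `b_n^{1-β_n} / (1-β_n)` in closed form. -/
lemma bseq_rpow_div_eq {n : ℕ} (hn : 0 < n) :
    bseq n ^ (1 - bet n) / (1 - bet n) =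
      1 / (n * Real.exp (√(Real.log n) / 2) * (Real.log n + 3 / 2 * √(Real.log n))) := by
  have hn0 : (0 : ℝ) < n := by exact_mod_cast hn
  have hg : 0 < gseq n := Real.exp_pos _
  have hlg : Real.log (gseq n) = √(Real.log n) := Real.log_exp _
  have hb : 1 - bet n = (Real.log n + 3 / 2 * √(Real.log n)) / gseq n := by
    rw [bet, hlg]; ring
  have hp : bseq n ^ (1 - bet n) =
      1 / (n * Real.exp (√(Real.log n) / 2) * gseq n) := by
    rw [bseq, ← Real.exp_mul, hb, neg_mul, mul_div_cancel₀ _ hg.ne', Real.exp_neg, one_div, gseq,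
      mul_assoc, ← Real.exp_add]
    nth_rewrite 3 [← Real.exp_log hn0]
    rw [← Real.exp_add]
    ring_nf
  rw [hp, hb, div_div, mul_assoc _ (gseq n), mul_div_cancel₀ _ hg.ne']

/-- Powers are dominated by `e^{√x/2}`. -/
lemma exists_rpow_le_mul_exp_half_sqrt (p : ℝ) :
    ∃ K > (0 : ℝ), ∀ x : ℝ, 1 ≤ x → x ^ p ≤ K * Real.exp (√x / 2) := by
  obtain ⟨m, hm⟩ := exists_nat_ge (2 * p)
  refine ⟨2 ^ m * m.factorial, by positivity, fun x hx ↦ ?_⟩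
  have hs : 1 ≤ √x := Real.one_le_sqrt.2 hx
  have hexp := Real.pow_div_factorial_le_exp (x := √x / 2) (by positivity) m
  rw [div_le_iff₀ (by positivity), div_pow, div_le_iff₀ (by positivity)] at hexp
  calc x ^ p = √x ^ (2 * p) := by
        rw [Real.rpow_mul (by positivity), Real.rpow_two, Real.sq_sqrt (by linarith)]
    _ ≤ √x ^ (m : ℝ) := Real.rpow_le_rpow_of_exponent_le hs hm
    _ = √x ^ m := Real.rpow_natCast _ _
    _ ≤ _ := by linarith

lemma exists_spike_term_le {α : ℝ} (hα : 0 < α) :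
    ∃ K > (0 : ℝ), ∀ n N : ℕ, 3 ≤ n → 3 ≤ N → n ≠ N →
      bseq n ^ (1 - bet n) / (1 - bet n) * Real.log (1 / |aseq n - aseq N|) ^ (1 + α) ≤
        K * (1 / (n * Real.log n ^ 2)) := by
  obtain ⟨K, hK, hle⟩ := exists_rpow_le_mul_exp_half_sqrt (α + 2)
  refine ⟨5 ^ (1 + α) * K, by positivity, fun n N hn hN hne ↦ ?_⟩
  have hL := one_le_log_natCast hn
  have hL0 : 0 < Real.log n := by linarith
  have hn0 : (0 : ℝ) < n := by positivity
  rw [bseq_rpow_div_eq (by lia)]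
  have hpow : Real.log n ^ (1 + α) * Real.log n = Real.log n ^ (α + 2) := by
    rw [← Real.rpow_add_one hL0.ne']; ring_nf
  have hnonneg := log_one_div_abs_aseq_sub_nonneg hn hN
  calc _ ≤ 1 / (n * Real.exp (√(Real.log n) / 2) * Real.log n) *
        (5 * Real.log n) ^ (1 + α) := by
        gcongr ?_ * ?_
        · gcongr
          linarith [Real.sqrt_nonneg (Real.log n)]
        · exact Real.rpow_le_rpow hnonneg (log_one_div_abs_aseq_sub_le hn hN hne) (by linarith)
    _ = 5 ^ (1 + α) * (Real.log n ^ (α + 2)) /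
        (n * Real.exp (√(Real.log n) / 2) * Real.log n ^ 2) := by
        rw [Real.mul_rpow (by norm_num) hL0.le, ← hpow]
        field_simp
    _ ≤ 5 ^ (1 + α) * (K * Real.exp (√(Real.log n) / 2)) /
        (n * Real.exp (√(Real.log n) / 2) * Real.log n ^ 2) := by
        gcongr
        exact hle _ hL
    _ = _ := by field_simp

theorem spike_sum_log_bound :
    ∀ α : ℝ, 0 < α → ∃ C > (0 : ℝ), ∀ N : ℕ, 10 ^ 9 ≤ N →
      (∑' n : ℕ, if 10 ^ 9 ≤ n ∧ n ≠ N then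
          ENNReal.ofReal ((bseq n ^ (1 - bet n) / (1 - bet n)) *
            (Real.log (1 / |aseq n - aseq N|)) ^ (1 + α))
        else 0) ≤ ENNReal.ofReal C := by
  intro α hα
  obtain ⟨K, hK, hle⟩ := exists_spike_term_le hα
  have hsum := summable_one_div_nat_mul_log_sq.mul_left K
  have hnonneg : ∀ n : ℕ, 0 ≤ K * (1 / ((n : ℝ) * Real.log n ^ 2)) := fun n ↦ by positivity
  refine ⟨∑' n : ℕ, K * (1 / ((n : ℝ) * Real.log n ^ 2)),
    hsum.tsum_pos hnonneg 3 ?_, fun N hN ↦ ?_⟩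
  · have h3 : 0 < Real.log ((3 : ℕ) : ℝ) := by linarith [one_le_log_natCast le_rfl]
    positivity
  rw [ENNReal.ofReal_tsum_of_nonneg hnonneg hsum]
  refine ENNReal.tsum_le_tsum fun n ↦ ?_
  split_ifs with h
  · exact ENNReal.ofReal_le_ofReal (hle n N (by lia) (by lia) h.2)
  · exact zero_le
end
end
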